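/- Discrete Jordan Curve Theorem: Let M be a planar hypermap with nc(M) connected components, and let l be a ring of faces in M. Let M' = Bl M l be obtained by breaking all the 0-links of the darts of l. Then nc(M') = nc(M) + 1. -/

import Mathlib

open scoped Classical

/-- Dimensions 0 and 1. -/
inductive Dim : Type
  | zero : Dim
  | one : Dim
deriving DecidableEq

/-- Free maps: empty map, dart insertion, dart linking at a dimension. -/
inductive Fmap : Type
  | V : Fmap
  | I : Fmap → Nat → Fmap
  | L : Fmap → Dim → Nat → Nat → Fmap

namespace Fmap

/-- The nil (exception) dart. -/
def nil : Nat := 0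

/-- A dart exists in the map. -/
def exd : Fmap → Nat → Prop
  | V, _ => False
  | I m0 x, z => z = x ∨ exd m0 z
  | L m0 _ _ _, z => exd m0 z

/-- The (partial) k-successor α_k, with nil for undefined. -/
def A : Fmap → Dim → Nat → Nat
  | V, _, _ => nil
  | I m0 _, k, z => A m0 k z
  | L m0 k0 x y, k, z =>
      if k = k0 then (if z = x then y else A m0 k z) else A m0 k z

/-- The (partial) k-predecessor. -/
def A_1 : Fmap → Dim → Nat → Nat
  | V, _, _ => nil
  | I m0 _, k, z => A_1 m0 k z
  | L m0 k0 x y, k, z =>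
      if k = k0 then (if z = y then x else A_1 m0 k z) else A_1 m0 k z

/-- z has a k-successor. -/
def succd (m : Fmap) (k : Dim) (z : Nat) : Prop := A m k z ≠ nil

/-- z has a k-predecessor. -/
def predd (m : Fmap) (k : Dim) (z : Nat) : Prop := A_1 m k z ≠ nil

/-- Bottom dart of the open k-orbit of z. -/
def bottom : Fmap → Dim → Nat → Nat
  | V, _, _ => nil
  | I m0 x, k, z => if z = x then z else bottom m0 k z
  | L m0 k0 x y, k, z =>
      if k = k0 then
        (if bottom m0 k z = y then bottom m0 k x else bottom m0 k z)
      else bottom m0 k z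

/-- Top dart of the open k-orbit of z. -/
def top : Fmap → Dim → Nat → Nat
  | V, _, _ => nil
  | I m0 x, k, z => if z = x then z else top m0 k z
  | L m0 k0 x y, k, z =>
      if k = k0 then
        (if top m0 k z = x then top m0 k y else top m0 k z)
      else top m0 k z

/-- Closure of A: a permutation of existing darts. -/
def cA : Fmap → Dim → Nat → Nat
  | V, _, _ => nil
  | I m0 x, k, z => if z = x then z else cA m0 k z
  | L m0 k0 x y, k, z =>
      if k = k0 then
        (if z = x then y
         else if z = top m0 k y then bottom m0 k x
         else cA m0 k z)
      else cA m0 k z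

/-- Closure of A_1: the inverse permutation of cA. -/
def cA_1 : Fmap → Dim → Nat → Nat
  | V, _, _ => nil
  | I m0 x, k, z => if z = x then z else cA_1 m0 k z
  | L m0 k0 x y, k, z =>
      if k = k0 then
        (if z = y then x
         else if z = bottom m0 k x then top m0 k y
         else cA_1 m0 k z)
      else cA_1 m0 k z

/-- Precondition for inserting a dart. -/
def prec_I (m : Fmap) (x : Nat) : Prop := x ≠ nil ∧ ¬ exd m x

/-- Precondition for linking two darts at a dimension (keeping orbits open). -/
def prec_L (m : Fmap) (k : Dim) (x y : Nat) : Prop :=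
  exd m x ∧ exd m y ∧ ¬ succd m k x ∧ ¬ predd m k y ∧ cA m k x ≠ y

/-- The hypermap invariant. -/
def inv_hmap : Fmap → Prop
  | V => True
  | I m0 x => inv_hmap m0 ∧ prec_I m0 x
  | L m0 k0 x y => inv_hmap m0 ∧ prec_L m0 k0 x y

/-- The closed face map cF, corresponding to φ = α₁⁻¹ ∘ α₀⁻¹. -/
def cF (m : Fmap) (z : Nat) : Nat := cA_1 m Dim.one (cA_1 m Dim.zero z)

/-- Two darts are in the same face (existence of a cF-path). -/
def expf (m : Fmap) (z t : Nat) : Prop := exd m z ∧ ∃ n : ℕ, (cF m)^[n] z = t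

/-- Two darts are in the same edge (existence of a (cA zero)-path). -/
def expe (m : Fmap) (z t : Nat) : Prop := exd m z ∧ ∃ n : ℕ, (fun w => cA m Dim.zero w)^[n] z = t

/-- Two darts are in the same connected component. -/
def eqc : Fmap → Nat → Nat → Prop
  | V, _, _ => False
  | I m0 x, z, t => (z = x ∧ t = x) ∨ eqc m0 z t
  | L m0 _ x y, z, t =>
      eqc m0 z t ∨ (eqc m0 z x ∧ eqc m0 y t) ∨ (eqc m0 z y ∧ eqc m0 x t)

/-- Number of darts. -/
def nd : Fmap → ℤ
  | V => 0
  | I m0 _ => nd m0 + 1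
  | L m0 _ _ _ => nd m0

/-- Number of vertices. -/
def nv : Fmap → ℤ
  | V => 0
  | I m0 _ => nv m0 + 1
  | L m0 Dim.zero _ _ => nv m0
  | L m0 Dim.one _ _ => nv m0 - 1

/-- Number of edges. -/
def ne : Fmap → ℤ
  | V => 0
  | I m0 _ => ne m0 + 1
  | L m0 Dim.zero _ _ => ne m0 - 1
  | L m0 Dim.one _ _ => ne m0

/-- Number of faces. -/
noncomputable def nf : Fmap → ℤ
  | V => 0
  | I m0 _ => nf m0 + 1
  | L m0 Dim.zero x y => if expf m0 (cA_1 m0 Dim.one x) y then nf m0 + 1 else nf m0 - 1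
  | L m0 Dim.one x y => if expf m0 x (cA m0 Dim.zero y) then nf m0 + 1 else nf m0 - 1

/-- Number of connected components. -/
noncomputable def nc : Fmap → ℤ
  | V => 0
  | I m0 _ => nc m0 + 1
  | L m0 _ x y => if eqc m0 x y then nc m0 else nc m0 - 1

/-- Euler characteristic. -/
noncomputable def ec (m : Fmap) : ℤ := nv m + ne m + nf m - nd m

/-- Genus. -/
noncomputable def genus (m : Fmap) : ℤ := nc m - ec m / 2

/-- Planarity. -/
def planar (m : Fmap) : Prop := genus m = 0

/-- Breaking the latest forward k-link of x. -/
def B : Fmap → Dim → Nat → Fmap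
  | V, _, _ => V
  | I m0 x0, k, x => I (B m0 k x) x0
  | L m0 k0 x0 y0, k, x =>
      if k = k0 ∧ x = x0 then m0 else L (B m0 k x) k0 x0 y0

/-- Breaking all the 0-links of the darts of a list, first one first. -/
def Bl (m : Fmap) : List (Nat × Bool) → Fmap
  | [] => m
  | (x, _) :: l0 => Bl (B m Dim.zero x) l0

/-- The dart representing the face coded by a double-link (x, b). -/
def faceDart (m : Fmap) : Nat × Bool → Nat
  | (x, b) => if b then A m Dim.zero x else bottom m Dim.zero x

/-- The edge of x is distinct from the edges of the darts of a list. -/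
def distinct_edge_list (m : Fmap) (x : Nat) : List (Nat × Bool) → Prop
  | [] => True
  | (x', _) :: l0 => distinct_edge_list m x l0 ∧ ¬ expe m x x'

/-- Ring condition (0): unicity of edges, and each dart 0-linked. -/
def pre_ring0 (m : Fmap) : List (Nat × Bool) → Prop
  | [] => True
  | (x, _) :: l0 => pre_ring0 m l0 ∧ distinct_edge_list m x l0 ∧ succd m Dim.zero x

/-- Adjacency of the faces coded by two double-links. -/
def adjacent_faces (m : Fmap) : Nat × Bool → Nat × Bool → Prop
  | (x, b), (x', b') =>
      let y := A m Dim.zero x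
      let y' := A m Dim.zero x'
      let x0 := bottom m Dim.zero x
      let x'0 := bottom m Dim.zero x'
      if b then (if b' then expf m x0 y' else expf m x0 x'0)
      else (if b' then expf m y y' else expf m y x'0)

/-- Ring condition (1): continuity. -/
def pre_ring1 (m : Fmap) : List (Nat × Bool) → Prop
  | [] => True
  | xb :: l0 =>
      pre_ring1 m l0 ∧
      match l0 with
      | [] => True
      | xb' :: _ => adjacent_faces m xb xb'

/-- Last element of a list of double-links (with default). -/
def lastd : List (Nat × Bool) → Nat × Bool
  | [] => (nil, true)
  | [a] => a
  | _ :: a :: l0 => lastd (a :: l0)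

/-- Ring condition (2): circularity. -/
def pre_ring2 (m : Fmap) : List (Nat × Bool) → Prop
  | [] => True
  | (x, b) :: l0 =>
      match l0 with
      | [] => expf m (A m Dim.zero x) (bottom m Dim.zero x)
      | _ :: _ => adjacent_faces m (lastd l0) (x, b)

/-- The faces coded by two double-links are distinct. -/
def distinct_faces (m : Fmap) (xb xb' : Nat × Bool) : Prop :=
  ¬ expf m (faceDart m xb) (faceDart m xb')

/-- The face of xb is distinct from the faces of a list. -/
def distinct_face_list (m : Fmap) (xb : Nat × Bool) : List (Nat × Bool) → Prop
  | [] => True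
  | xb' :: l0 => distinct_face_list m xb l0 ∧ distinct_faces m xb xb'

/-- Ring condition (3): simplicity. -/
def pre_ring3 (m : Fmap) : List (Nat × Bool) → Prop
  | [] => True
  | xb :: l0 => pre_ring3 m l0 ∧ distinct_face_list m xb l0

/-- A ring of faces. -/
def ring (m : Fmap) (l : List (Nat × Bool)) : Prop :=
  l ≠ [] ∧ pre_ring0 m l ∧ pre_ring1 m l ∧ pre_ring2 m l ∧ pre_ring3 m l

end Fmap

open Fmap

namespace JC

open Equiv Equiv.Perm



/-- The partial equivalence obtained from R by merging the classes of x and y. -/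
def mrg (R : ℕ → ℕ → Prop) (x y : ℕ) (z t : ℕ) : Prop :=
  R z t ∨ (R z x ∧ R y t) ∨ (R z y ∧ R x t)

lemma inv_mem_of_finite {σ : Perm ℕ} {S : Set ℕ} (hS : S.Finite) (h : ∀ z ∈ S, σ z ∈ S) :
    ∀ z ∈ S, σ⁻¹ z ∈ S := by
  intro z hz
  have : σ '' S = S :=
    Set.eq_of_subset_of_ncard_le (by rintro _ ⟨w, hw, rfl⟩; exact h w hw)
      (by rw [Set.ncard_image_of_injective _ σ.injective]) hS
  rw [← this] at hz
  obtain ⟨w, hw, rfl⟩ := hz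
  simpa using hw

lemma sameCycle_mem {σ : Perm ℕ} {S : Set ℕ} (hS : S.Finite) (h : ∀ z ∈ S, σ z ∈ S)
    {x y : ℕ} (hx : x ∈ S) (hxy : SameCycle σ x y) : y ∈ S := by
  obtain ⟨i, rfl⟩ := hxy
  have h' := inv_mem_of_finite hS h
  induction i using Int.induction_on with
  | zero => simpa
  | succ n ih => rw [add_comm, zpow_add]; simpa using h _ ih
  | pred n ih =>
    rw [sub_eq_add_neg, add_comm, zpow_add]; simpa using h' _ ih

lemma exists_nat_pow {σ : Perm ℕ} (D : Finset ℕ) (hD : ∀ z, z ∉ D → σ z = z) {x y : ℕ}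
    (h : SameCycle σ x y) : ∃ n : ℕ, (σ ^ n) x = y := by
  have hDm : ∀ z ∈ D, σ z ∈ D := by
    intro z hz
    by_contra hc
    have := σ.injective (hD _ hc)
    rw [this] at hc; exact hc hz
  let S : Set ℕ := {z | ∃ n : ℕ, (σ ^ n) x = z}
  have hS : S.Finite := by
    apply Set.Finite.subset (insert x D).finite_toSet
    rintro z ⟨n, rfl⟩
    induction n with
    | zero => simp
    | succ n ih =>
      rw [pow_succ', mul_apply]
      simp only [Finset.coe_insert, Set.mem_insert_iff, Finset.mem_coe] at ih ⊢
      by_cases hw : (σ ^ n) x ∈ D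
      · right; exact hDm _ hw
      · rw [hD _ hw]; exact ih
  have := sameCycle_mem hS (σ := σ) (by
    rintro z ⟨n, rfl⟩; exact ⟨n + 1, by rw [pow_succ', mul_apply]⟩) (x := x) ⟨0, rfl⟩ h
  exact this

lemma not_sameCycle_aux {σ : Perm ℕ} {x y : ℕ} (hne : x ≠ y) (n : ℕ) (h : (σ ^ n) x = y) :
    ¬ SameCycle (σ * swap x y) y x := by
  classical
  have hex : ∃ n : ℕ, (σ ^ n) x = y := ⟨n, h⟩
  let N := Nat.find hex
  have hN : (σ ^ N) x = y := Nat.find_spec hex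
  have hmin : ∀ k < N, (σ ^ k) x ≠ y := fun k hk => Nat.find_min hex hk
  have hN0 : 0 < N := by
    rcases Nat.eq_zero_or_pos N with h0 | h0
    · rw [h0] at hN; exact absurd hN hne
    · exact h0
  let S : Set ℕ := (fun i => (σ ^ i) x) '' (Set.Icc 1 N)
  have hS : S.Finite := (Set.finite_Icc 1 N).image _
  have hxS : x ∉ S := by
    rintro ⟨i, ⟨h1, h2⟩, hi⟩
    simp only at hi
    apply hmin (N - i) (by omega)
    have : (σ ^ (N - i)) ((σ ^ i) x) = y := by
      rw [← mul_apply, ← pow_add, Nat.sub_add_cancel h2]; exact hN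
    rwa [hi] at this
  intro hc
  refine hxS (sameCycle_mem hS (σ := σ * swap x y) ?_ (x := y) ⟨N, ⟨hN0, le_rfl⟩, hN⟩ hc)
  rintro z hz
  have hzx : z ≠ x := fun e => hxS (e ▸ hz)
  by_cases hzy : z = y
  · subst hzy
    exact ⟨1, ⟨le_rfl, hN0⟩, by simp⟩
  · obtain ⟨i, ⟨h1, h2⟩, hi⟩ := hz
    simp only at hi
    have : i ≠ N := by rintro rfl; exact hzy (hi ▸ hN)
    refine ⟨i + 1, ⟨by omega, by omega⟩, ?_⟩
    simp only [mul_apply, swap_apply_of_ne_of_ne hzx hzy]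
    rw [pow_succ', mul_apply, hi]

lemma not_sameCycle_of {σ : Perm ℕ} {x y : ℕ} (hne : x ≠ y) (h : SameCycle σ x y) :
    ¬ SameCycle (σ * swap x y) x y := by
  obtain ⟨i, hi⟩ := h
  rcases Int.eq_nat_or_neg i with ⟨n, rfl | rfl⟩
  · have := not_sameCycle_aux hne n (by simpa using hi)
    rwa [sameCycle_comm]
  · have h2 : (σ ^ n) y = x := by
      rw [← hi]; simp
    have := not_sameCycle_aux hne.symm n h2
    rwa [swap_comm] at this

lemma sameCycle_of_not {σ : Perm ℕ} (D : Finset ℕ) (hD : ∀ z, z ∉ D → σ z = z) {x y : ℕ}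
    (h : ¬ SameCycle σ x y) : SameCycle (σ * swap x y) x y := by
  classical
  -- some positive power fixes x
  obtain ⟨p, hp⟩ := exists_nat_pow D hD (x := σ x) (y := x) (by simp [SameCycle.refl])
  have key : ∀ n : ℕ, SameCycle (σ * swap x y) y ((σ ^ n) (σ x)) ∨
      SameCycle (σ * swap x y) y x := by
    intro n
    induction n with
    | zero =>
      left
      refine ⟨1, by simp⟩
    | succ n ih =>
      rcases ih with ih | ih
      · by_cases hx : (σ ^ n) (σ x) = x
        · right; rwa [hx] at ih
        · left
          have hy : (σ ^ n) (σ x) ≠ y := by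
            intro hy
            apply h
            refine ⟨(n + 1 : ℕ), ?_⟩
            rw [zpow_natCast, pow_succ, mul_apply, hy]
          have : (σ ^ (n + 1)) (σ x) = (σ * swap x y) ((σ ^ n) (σ x)) := by
            rw [mul_apply, swap_apply_of_ne_of_ne hx hy, pow_succ', mul_apply]
          rw [this, sameCycle_apply_right]; exact ih
      · right; exact ih
  rcases key p with h1 | h1
  · rw [hp] at h1; exact h1.symm
  · exact h1.symm

lemma mrg_of_sameCycle {σ : Perm ℕ} {x y z t : ℕ} (h : SameCycle (σ * swap x y) z t) :
    mrg (SameCycle σ) x y z t := by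
  have hs : ∀ w, mrg (SameCycle σ) x y w ((σ * swap x y) w) := by
    intro w
    by_cases h1 : w = x
    · subst h1; right; left; simp [SameCycle.refl]
    · by_cases h2 : w = y
      · subst h2; right; right; simp [SameCycle.refl]
      · left; simp [swap_apply_of_ne_of_ne h1 h2, SameCycle.refl]
  have htr : ∀ a b c, mrg (SameCycle σ) x y a b → mrg (SameCycle σ) x y b c →
      mrg (SameCycle σ) x y a c := by
    have T : ∀ a b c, SameCycle σ a b → SameCycle σ b c → SameCycle σ a c :=
      fun a b c h1 h2 => h1.trans h2
    have Sy : ∀ a b, SameCycle σ a b → SameCycle σ b a := fun a b h1 => h1.symm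
    unfold mrg
    generalize SameCycle σ = R at *
    grind
  have hsy : ∀ a b, mrg (SameCycle σ) x y a b → mrg (SameCycle σ) x y b a := by
    have Sy : ∀ a b, SameCycle σ a b → SameCycle σ b a := fun a b h1 => h1.symm
    unfold mrg
    generalize SameCycle σ = R at *
    grind
  obtain ⟨i, rfl⟩ := h
  induction i using Int.induction_on with
  | zero => left; simp [SameCycle.refl]
  | succ n ih =>
    refine htr _ _ _ ih ?_
    rw [add_comm, zpow_add, zpow_one, mul_apply]
    exact hs _
  | pred n ih =>
    refine htr _ _ _ ih (hsy _ _ ?_)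
    have := hs (((σ * swap x y) ^ (-(n:ℤ) - 1)) z)
    rwa [← mul_apply, ← zpow_one_add, add_sub_cancel] at this

lemma mrg_symm_args {R : ℕ → ℕ → Prop} {x y z t} : mrg R x y z t ↔ mrg R y x z t := by
  unfold mrg; tauto

lemma mrg_mono {R S : ℕ → ℕ → Prop} {x y z t} (h : ∀ a b, R a b → S a b)
    (hm : mrg R x y z t) : mrg S x y z t := by
  unfold mrg at *
  rcases hm with h1 | ⟨h1, h2⟩ | ⟨h1, h2⟩
  · exact .inl (h _ _ h1)
  · exact .inr (.inl ⟨h _ _ h1, h _ _ h2⟩)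
  · exact .inr (.inr ⟨h _ _ h1, h _ _ h2⟩)

/-- multiplying by a transposition joining two cycles. -/
lemma sameCycle_iff_mrg {σ : Perm ℕ} (D : Finset ℕ) (hD : ∀ z, z ∉ D → σ z = z) {x y : ℕ}
    (h : ¬ SameCycle σ x y) (z t : ℕ) :
    SameCycle (σ * swap x y) z t ↔ mrg (SameCycle σ) x y z t := by
  refine ⟨mrg_of_sameCycle, ?_⟩
  have hs := sameCycle_of_not D hD h
  have hsub : ∀ a b, SameCycle σ a b → SameCycle (σ * swap x y) a b := by
    intro a b hab
    have : σ = (σ * swap x y) * swap x y := by rw [mul_assoc, swap_mul_self, mul_one]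
    rw [this] at hab
    rcases mrg_of_sameCycle hab with h1 | ⟨h1, h2⟩ | ⟨h1, h2⟩
    · exact h1
    · exact (h1.trans hs).trans h2
    · exact (h1.trans hs.symm).trans h2
  rintro (h1 | ⟨h1, h2⟩ | ⟨h1, h2⟩)
  · exact hsub _ _ h1
  · exact ((hsub _ _ h1).trans hs).trans (hsub _ _ h2)
  · exact ((hsub _ _ h1).trans hs.symm).trans (hsub _ _ h2)

/-- number of classes of R meeting D. -/
noncomputable def cnt (D : Finset ℕ) (R : ℕ → ℕ → Prop) : ℤ :=
  ((D.image (fun z => {t | R z t})).card : ℤ)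

lemma cl_eq_iff {R : ℕ → ℕ → Prop} (sy : ∀ a b, R a b → R b a)
    (tr : ∀ a b c, R a b → R b c → R a c) {z t : ℕ} (rt : R t t) :
    {w | R z w} = {w | R t w} ↔ R z t := by
  constructor
  · intro h
    have : t ∈ {w | R t w} := rt
    rw [← h] at this; exact this
  · intro h; ext w
    exact ⟨fun h1 => tr _ _ _ (sy _ _ h) h1, fun h1 => tr _ _ _ h h1⟩

lemma cnt_mrg {D : Finset ℕ} {R : ℕ → ℕ → Prop} (re : ∀ a ∈ D, R a a)
    (sy : ∀ a b, R a b → R b a) (tr : ∀ a b c, R a b → R b c → R a c)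
    {x y : ℕ} (hx : x ∈ D) (hy : y ∈ D) (hn : ¬ R x y) :
    cnt D (mrg R x y) = cnt D R - 1 := by
  classical
  have msy : ∀ a b, mrg R x y a b → mrg R x y b a := by unfold mrg; grind
  have mtr : ∀ a b c, mrg R x y a b → mrg R x y b c → mrg R x y a c := by unfold mrg; grind
  let D0 := D.filter (fun z => ¬ R z x)
  have hyD0 : y ∈ D0 := by simp [D0, hy]; exact fun h => hn (sy _ _ h)
  have e1 : D.image (fun z => {t | R z t}) =
      insert {t | R x t} (D0.image (fun z => {t | R z t})) := by
    ext S
    simp only [Finset.mem_image, Finset.mem_insert, D0, Finset.mem_filter]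
    constructor
    · rintro ⟨z, hz, rfl⟩
      by_cases hzx : R z x
      · left; exact (cl_eq_iff sy tr (re _ hx)).2 hzx
      · right; exact ⟨z, ⟨hz, hzx⟩, rfl⟩
    · rintro (rfl | ⟨z, ⟨hz, _⟩, rfl⟩)
      · exact ⟨x, hx, rfl⟩
      · exact ⟨z, hz, rfl⟩
  have e2 : {t | R x t} ∉ (D0.image (fun z => {t | R z t})) := by
    simp only [Finset.mem_image, D0, Finset.mem_filter]
    rintro ⟨z, ⟨hz, hzx⟩, h⟩
    exact hzx ((cl_eq_iff sy tr (re _ hx)).1 h)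
  have e3 : D.image (fun z => {t | mrg R x y z t}) = D0.image (fun z => {t | mrg R x y z t}) := by
    apply Finset.Subset.antisymm
    · intro S
      simp only [Finset.mem_image]
      rintro ⟨z, hz, rfl⟩
      by_cases hzx : R z x
      · refine ⟨y, hyD0, ?_⟩
        refine (cl_eq_iff msy mtr (.inl (re _ hz))).2 ?_
        exact .inr (.inr ⟨re _ hy, sy _ _ hzx⟩)
      · exact ⟨z, by simp [D0, hz, hzx], rfl⟩
    · exact Finset.image_subset_image (Finset.filter_subset _ _)
  let g : Set ℕ → Set ℕ := fun S => {t | ∃ s ∈ S, mrg R x y s t}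
  have e4 : D0.image (fun z => {t | mrg R x y z t}) =
      (D0.image (fun z => {t | R z t})).image g := by
    rw [Finset.image_image]
    apply Finset.image_congr
    intro z hz
    have hz' : z ∈ D := (Finset.mem_filter.1 hz).1
    ext t
    simp only [g, Function.comp, Set.mem_ofPred_eq]
    constructor
    · intro h; exact ⟨z, re _ hz', h⟩
    · rintro ⟨s, hs, h⟩; exact mtr _ _ _ (.inl hs) h
  have e5 : ((D0.image (fun z => {t | R z t})).image g).card =
      (D0.image (fun z => {t | R z t})).card := by
    rw [← e4]
    have hg := e4
    apply le_antisymm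
    · rw [e4]; exact Finset.card_image_le
    · rw [e4]
      apply le_of_eq; symm
      apply Finset.card_image_of_injOn
      intro S hS T hT hST
      simp only [Finset.coe_image, Set.mem_image, Finset.mem_coe, D0, Finset.mem_filter] at hS hT
      obtain ⟨z, ⟨hz, hzx⟩, rfl⟩ := hS
      obtain ⟨t, ⟨ht, htx⟩, rfl⟩ := hT
      have : t ∈ g {w | R t w} := ⟨t, re _ ht, .inl (re _ ht)⟩
      rw [← hST] at this
      obtain ⟨s, hs, hm⟩ := this
      have hs' : R z s := hs
      have hm2 : mrg R x y z t := mtr _ _ _ (.inl hs') hm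
      apply (cl_eq_iff sy tr (re _ ht)).2
      rcases hm2 with h | ⟨h, _⟩ | ⟨_, h⟩
      · exact h
      · exact absurd h hzx
      · exact absurd (sy _ _ h) htx
  unfold cnt
  rw [e3, e4, e5, e1, Finset.card_insert_of_notMem e2]
  push_cast; ring

lemma mrg_of_rel {R : ℕ → ℕ → Prop}
    (sy : ∀ a b, R a b → R b a) (tr : ∀ a b c, R a b → R b c → R a c)
    {x y : ℕ} (h : R x y) : mrg R x y = R := by
  funext z t
  apply propext
  unfold mrg; grind

lemma cnt_insert {D : Finset ℕ} {R : ℕ → ℕ → Prop} {x : ℕ} (hx : R x x)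
    (hn : ∀ z ∈ D, ¬ R z x) : cnt (insert x D) R = cnt D R + 1 := by
  classical
  unfold cnt
  rw [Finset.image_insert, Finset.card_insert_of_notMem]
  · push_cast; ring
  · simp only [Finset.mem_image]
    rintro ⟨z, hz, h⟩
    have : x ∈ {t | R x t} := hx
    rw [← h] at this
    exact hn z hz this

/-- the effect of a transposition on the number of cycles. -/
lemma cnt_swap {σ : Perm ℕ} {D : Finset ℕ} (hD : ∀ z, z ∉ D → σ z = z) {x y : ℕ}
    (hx : x ∈ D) (hy : y ∈ D) (hne : x ≠ y) :
    (SameCycle σ x y → cnt D (SameCycle (σ * swap x y)) = cnt D (SameCycle σ) + 1) ∧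
    (¬ SameCycle σ x y → cnt D (SameCycle (σ * swap x y)) = cnt D (SameCycle σ) - 1) := by
  have sy : ∀ (σ : Perm ℕ), ∀ a b, SameCycle σ a b → SameCycle σ b a := fun _ _ _ h => h.symm
  have tr : ∀ (σ : Perm ℕ), ∀ a b c, SameCycle σ a b → SameCycle σ b c → SameCycle σ a c :=
    fun _ _ _ _ h h' => h.trans h'
  constructor <;> intro h
  · have h' := not_sameCycle_of hne h
    have hD' : ∀ z, z ∉ D → (σ * swap x y) z = z := by
      intro z hz
      rw [mul_apply, swap_apply_of_ne_of_ne (by rintro rfl; exact hz hx)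
        (by rintro rfl; exact hz hy), hD z hz]
    have e : σ = (σ * swap x y) * swap x y := by rw [mul_assoc, swap_mul_self, mul_one]
    have e2 : SameCycle σ = mrg (SameCycle (σ * swap x y)) x y := by
      funext z t; apply propext
      conv_lhs => rw [e]
      exact sameCycle_iff_mrg D hD' h' z t
    rw [e2, cnt_mrg (fun a _ => SameCycle.refl _ a) (sy _) (tr _) hx hy h']
    ring
  · have e2 : SameCycle (σ * swap x y) = mrg (SameCycle σ) x y := by
      funext z t; apply propext; exact sameCycle_iff_mrg D hD h z t
    rw [e2, cnt_mrg (fun a _ => SameCycle.refl _ a) (sy _) (tr _) hx hy h]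


/-- The permutation closing the k-predecessor function. -/
noncomputable def Q : Fmap → Dim → Perm ℕ
  | V, _ => 1
  | I m0 _, k => Q m0 k
  | L m0 k0 x y, k => if k = k0 then Q m0 k * swap y (bottom m0 k x) else Q m0 k

/-- set of darts. -/
noncomputable def ds : Fmap → Finset ℕ
  | V => ∅
  | I m0 x => insert x (ds m0)
  | L m0 _ _ _ => ds m0

lemma mem_ds (m : Fmap) (z : ℕ) : z ∈ ds m ↔ exd m z := by
  induction m with
  | V => simp [ds, exd]
  | I m x ih => simp [ds, exd, ih]
  | L m k x y ih => simpa [ds, exd] using ih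

structure Good (m : Fmap) : Prop where
  nz : ∀ z, exd m z → z ≠ 0
  exb : ∀ k z, exd m z → exd m (bottom m k z)
  ext : ∀ k z, exd m z → exd m (top m k z)
  qfix : ∀ k z, ¬ exd m z → Q m k z = z
  q : ∀ k z, exd m z → cA_1 m k z = Q m k z
  qc : ∀ k z, exd m z → Q m k (cA m k z) = z
  qb : ∀ k z, exd m z → Q m k (bottom m k z) = top m k z
  topx : ∀ k z, exd m z → A m k z = 0 → top m k z = z
  boty : ∀ k z, exd m z → A_1 m k z = 0 → bottom m k z = z
  idem : ∀ k z, exd m z → bottom m k (bottom m k z) = bottom m k z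
  botQ : ∀ k z, exd m z → bottom m k (Q m k z) = bottom m k z
  botS : ∀ k z, exd m z → SameCycle (Q m k) z (bottom m k z)
  Aex : ∀ k z, A m k z ≠ 0 → exd m z ∧ exd m (A m k z) ∧ A_1 m k (A m k z) = z
  A1ex : ∀ k z, A_1 m k z ≠ 0 → exd m z ∧ exd m (A_1 m k z) ∧ A m k (A_1 m k z) = z
  cAb : ∀ k z, exd m z → A m k z = 0 → cA m k z = bottom m k z

lemma Good.exq {m : Fmap} (h : Good m) (k : Dim) (z : ℕ) : exd m (Q m k z) ↔ exd m z := by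
  by_cases hz : exd m z
  · refine ⟨fun _ => hz, fun _ => ?_⟩
    by_contra hc
    have := (Q m k).injective (h.qfix k _ hc)
    rw [this] at hc; exact hc hz
  · rw [h.qfix k z hz]

lemma good_V : Good V := by
  constructor <;> simp [exd, Q, A, A_1, nil]

lemma good_I {m : Fmap} {a : ℕ} (h : Good m) (hp : prec_I m a) : Good (I m a) := by
  obtain ⟨h0, h1⟩ := hp
  have hqa : ∀ k, Q m k a = a := fun k => h.qfix k a h1
  have hA : ∀ k, A m k a = 0 := fun k => by
    by_contra hc; exact h1 (h.Aex k a hc).1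
  have hA1 : ∀ k, A_1 m k a = 0 := fun k => by
    by_contra hc; exact h1 (h.A1ex k a hc).1
  have hq := h.exq
  have hb := h.exb
  have ht := h.ext
  have hqn : ∀ k z, z ≠ a → Q m k z ≠ a := by
    intro k z hz hc; rw [← hqa k] at hc; exact hz ((Q m k).injective hc)
  constructor
  · simp only [exd, forall_eq_or_imp]; exact ⟨h0, h.nz⟩
  · simp only [exd, bottom]; grind
  · simp only [exd, top]; grind
  · simp only [exd, Q]; intro k z hz; exact h.qfix k z (by tauto)
  · simp only [exd, Q, cA_1]; have := h.q; grind
  · simp only [exd, Q, cA]; have := h.qc; grind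
  · simp only [exd, Q, bottom, top]; have := h.qb; grind
  · simp only [exd, A, top]; have := h.topx; grind
  · simp only [exd, A_1, bottom]; have := h.boty; grind
  · simp only [exd, bottom]; have := h.idem; grind
  · simp only [exd, Q, bottom]; have := h.botQ; grind
  · simp only [exd, Q, bottom]
    intro k z hz
    by_cases hza : z = a
    · simp only [hza, if_true]; exact SameCycle.refl _ _
    · simp only [hza, if_false]; exact h.botS k z (by tauto)
  · simp only [exd, A, A_1]; have := h.Aex; grind
  · simp only [exd, A, A_1]; have := h.A1ex; grind
  · simp only [exd, A, cA, bottom]; have := h.cAb; grind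

lemma Good.not_same {m : Fmap} (h : Good m) {k : Dim} {z t : ℕ} (hz : exd m z)
    (hs : SameCycle (Q m k) z t) : exd m t ∧ bottom m k t = bottom m k z := by
  obtain ⟨n, rfl⟩ := exists_nat_pow (ds m) (fun w hw => h.qfix k w (by rwa [mem_ds] at hw)) hs
  induction n with
  | zero => simpa using hz
  | succ n ih =>
    have ih := ih ⟨n, by simp⟩
    rw [pow_succ', mul_apply]
    exact ⟨(h.exq _ _).2 ih.1, by rw [h.botQ k _ ih.1, ih.2]⟩

lemma Good.same_iff {m : Fmap} (h : Good m) {k : Dim} {z t : ℕ} (hz : exd m z) (ht : exd m t) :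
    SameCycle (Q m k) z t ↔ bottom m k z = bottom m k t := by
  constructor
  · intro hs; exact (h.not_same hz hs).2.symm
  · intro hs
    have h1 := h.botS k z hz
    have h2 := h.botS k t ht
    rw [hs] at h1; exact h1.trans h2.symm

lemma Good.prec {m : Fmap} (h : Good m) (k : Dim) (x y : ℕ) : prec_L m k x y ↔
    exd m x ∧ exd m y ∧ A m k x = 0 ∧ A_1 m k y = 0 ∧ bottom m k x ≠ y := by
  have := h.cAb k x
  simp only [prec_L, succd, predd, nil]
  grind

set_option maxHeartbeats 2000000 in
lemma good_L {m : Fmap} {k : Dim} {x y : ℕ} (h : Good m) (hp : prec_L m k x y) :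
    Good (L m k x y) := by
  rw [h.prec] at hp
  obtain ⟨hx, hy, hAx, hAy, hb⟩ := hp
  have hty := h.topx k x hx hAx
  have hby := h.boty k y hy hAy
  have hQx : Q m k (bottom m k x) = x := by rw [h.qb k x hx, hty]
  have hQy : Q m k y = top m k y := by conv_lhs => rw [← hby]
                                       exact h.qb k y hy
  have hib := h.idem k x hx
  have hinj : ∀ a b, Q m k a = Q m k b → a = b := fun a b e => (Q m k).injective e
  have hy0 := h.nz y hy
  have hx0 := h.nz x hx
  have hex := h.exb
  have het := h.ext
  have hqb := h.qb
  have hnz := h.nz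
  have hQ : ∀ z, Q (L m k x y) k z = if z = y then x else if z = bottom m k x then top m k y
      else Q m k z := by
    intro z
    simp only [Q, if_true, mul_apply, swap_apply_def]
    split_ifs <;> simp_all
  have hQ' : ∀ k', k' ≠ k → Q (L m k x y) k' = Q m k' := by
    intro k' hk; simp [Q, hk]
  have hfin : ∀ z, z ∉ ds m → Q m k z = z := fun w hw => h.qfix k w (by rwa [mem_ds] at hw)
  have hns : ¬ SameCycle (Q m k) y (bottom m k x) := by
    intro hc
    have := (h.not_same hy hc).2
    rw [hib, hby] at this; exact hb this
  have hQL : Q (L m k x y) k = Q m k * swap y (bottom m k x) := by simp [Q]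
  have hS := sameCycle_iff_mrg (ds m) hfin hns
  rw [← hQL] at hS
  constructor
  · exact hnz
  · simp only [exd, bottom]; grind
  · simp only [exd, top]; grind
  · intro k' z hz
    by_cases hk : k' = k
    · subst hk; rw [hQ]; have := h.qfix k' z hz; simp only [exd] at hz; grind
    · rw [hQ' _ hk]; exact h.qfix k' z hz
  · intro k' z hz
    by_cases hk : k' = k
    · subst hk; rw [hQ]; have := h.q k' z hz; simp only [cA_1]; grind
    · rw [hQ' _ hk]; simp only [cA_1, hk, if_false]; exact h.q k' z hz
  · intro k' z hz
    by_cases hk : k' = k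
    · subst hk; rw [hQ]; have := h.qc k' z hz; simp only [cA]; grind
    · rw [hQ' _ hk]; simp only [cA, hk, if_false]; exact h.qc k' z hz
  · intro k' z hz
    by_cases hk : k' = k
    · subst hk; rw [hQ]; have := h.qb k' z hz; simp only [bottom, top]
      have h2 := hqb k' y hy
      grind
    · rw [hQ' _ hk]; simp only [bottom, top, hk, if_false]; exact h.qb k' z hz
  · intro k' z hz; have := h.topx k' z hz; simp only [A, top]; grind
  · intro k' z hz; have := h.boty k' z hz; simp only [A_1, bottom]; grind
  · intro k' z hz; have := h.idem k' z hz; simp only [bottom]; grind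
  · intro k' z hz
    by_cases hk : k' = k
    · subst hk; rw [hQ]; have := h.botQ k' z hz; simp only [bottom]
      have h2 : bottom m k' (top m k' y) = y := by rw [← hQy, h.botQ k' y hy, hby]
      grind
    · rw [hQ' _ hk]; simp only [bottom, hk, if_false]; exact h.botQ k' z hz
  · intro k' z hz
    by_cases hk : k' = k
    · subst hk
      rw [hS]
      have := h.botS k' z hz
      simp only [bottom, if_true]
      split_ifs with hc
      · right; left; rw [hc] at this; exact ⟨this, SameCycle.refl _ _⟩
      · left; exact this
    · rw [hQ' _ hk]; simp only [bottom, hk, if_false]; exact h.botS k' z hz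
  · intro k' z
    have h1 := h.Aex k' z
    have h3 := hnz z
    clear hnz hqb hex het hinj hQ hQ' hS hfin
    simp only [exd, A, A_1]
    by_cases hk : k' = k
    · subst hk; grind
    · simpa [hk] using h1
  · intro k' z
    have h1 := h.A1ex k' z
    have h3 := hnz z
    clear hnz hqb hex het hinj hQ hQ' hS hfin
    simp only [exd, A, A_1]
    by_cases hk : k' = k
    · subst hk; grind
    · simpa [hk] using h1
  · intro k' z hz
    by_cases hk : k' = k
    · subst hk
      simp only [A, cA, bottom, if_true]
      intro hA
      have hzx : z ≠ x := by rintro rfl; simp at hA; exact hy0 hA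
      simp only [hzx, if_false] at hA ⊢
      have h1 := h.cAb k' z hz hA
      have h2 := h.qb k' z hz
      have h3 := h.topx k' z hz hA
      grind
    · simp only [A, cA, bottom, hk, if_false]; exact h.cAb k' z hz

lemma good (m : Fmap) (h : inv_hmap m) : Good m := by
  induction m with
  | V => exact good_V
  | I m x ih => exact good_I (ih h.1) h.2
  | L m k x y ih => exact good_L (ih h.1) h.2

lemma eqc_L (m : Fmap) (k : Dim) (x y : ℕ) : eqc (L m k x y) = mrg (eqc m) x y := rfl

lemma eqc_exd {m : Fmap} (h : inv_hmap m) {z t : ℕ} (he : eqc m z t) : exd m z ∧ exd m t := by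
  induction m generalizing z t with
  | V => exact he.elim
  | I m x ih =>
    rcases he with ⟨rfl, rfl⟩ | he
    · exact ⟨.inl rfl, .inl rfl⟩
    · exact ⟨.inr (ih h.1 he).1, .inr (ih h.1 he).2⟩
  | L m k x y ih =>
    rcases he with he | ⟨h1, h2⟩ | ⟨h1, h2⟩
    · exact ih h.1 he
    · exact ⟨(ih h.1 h1).1, (ih h.1 h2).2⟩
    · exact ⟨(ih h.1 h1).1, (ih h.1 h2).2⟩

lemma eqc_refl {m : Fmap} {z : ℕ} (he : exd m z) : eqc m z z := by
  induction m with
  | V => exact he.elim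
  | I m x ih =>
    rcases he with rfl | he
    · exact .inl ⟨rfl, rfl⟩
    · exact .inr (ih he)
  | L m k x y ih => exact .inl (ih he)

lemma eqc_symm {m : Fmap} {z t : ℕ} (he : eqc m z t) : eqc m t z := by
  induction m generalizing z t with
  | V => exact he.elim
  | I m x ih =>
    rcases he with ⟨rfl, rfl⟩ | he
    · exact .inl ⟨rfl, rfl⟩
    · exact .inr (ih he)
  | L m k x y ih =>
    rcases he with he | ⟨h1, h2⟩ | ⟨h1, h2⟩
    · exact .inl (ih he)
    · exact .inr (.inr ⟨ih h2, ih h1⟩)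
    · exact .inr (.inl ⟨ih h2, ih h1⟩)

lemma eqc_trans {m : Fmap} (h : inv_hmap m) {a b c : ℕ} (h1 : eqc m a b) (h2 : eqc m b c) :
    eqc m a c := by
  induction m generalizing a b c with
  | V => exact h1.elim
  | I m x ih =>
    rcases h1 with ⟨rfl, rfl⟩ | h1
    · exact h2
    · rcases h2 with ⟨rfl, rfl⟩ | h2
      · exact absurd (eqc_exd h.1 h1).2 h.2.2
      · exact .inr (ih h.1 h1 h2)
  | L m k x y ih =>
    have T : ∀ a b c, eqc m a b → eqc m b c → eqc m a c := fun a b c => ih h.1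
    have S : ∀ a b, eqc m a b → eqc m b a := fun a b => eqc_symm
    rw [eqc_L] at *
    unfold mrg at *
    grind

lemma eqc_Q_bot {m : Fmap} (h : inv_hmap m) (k : Dim) (z : ℕ) (hz : exd m z) :
    eqc m (Q m k z) z ∧ eqc m (bottom m k z) z := by
  induction m generalizing z with
  | V => exact hz.elim
  | I m x ih =>
    simp only [Q, bottom]
    by_cases hzx : z = x
    · subst hzx
      rw [(good m h.1).qfix k z h.2.2]
      simp only [if_true]
      exact ⟨.inl ⟨rfl, rfl⟩, .inl ⟨rfl, rfl⟩⟩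
    · have hz' : exd m z := hz.resolve_left hzx
      simp only [hzx, if_false]
      exact ⟨.inr (ih h.1 z hz').1, .inr (ih h.1 z hz').2⟩
  | L m k0 x y ih =>
    have hz' : exd m z := hz
    have T : ∀ a b c, eqc m a b → eqc m b c → eqc m a c := fun a b c => eqc_trans h.1
    have S : ∀ a b, eqc m a b → eqc m b a := fun a b => eqc_symm
    by_cases hk : k = k0
    · subst hk
      have hx : exd m x := h.2.1
      have hy : exd m y := h.2.2.1
      have ihx := ih h.1 x hx
      have ihb := ih h.1 _ ((good m h.1).exb k x hx)
      have ihy := ih h.1 y hy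
      have ihz := ih h.1 z hz'
      have rx := eqc_refl hx
      have ry := eqc_refl hy
      simp only [Q, bottom, if_true, mul_apply, eqc_L]
      constructor
      · by_cases h1 : z = y
        · subst h1
          rw [swap_apply_left]
          exact .inr (.inl ⟨T _ _ _ ihb.1 ihx.2, ry⟩)
        · by_cases h2 : z = bottom m k x
          · rw [h2, swap_apply_right]
            exact .inr (.inr ⟨ihy.1, S _ _ ihx.2⟩)
          · rw [swap_apply_of_ne_of_ne h1 h2]
            exact .inl ihz.1
      · split_ifs with h1
        · rw [h1] at ihz
          exact .inr (.inl ⟨ihx.2, ihz.2⟩)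
        · exact .inl ihz.2
    · simp only [Q, bottom, hk, if_false]
      exact ⟨.inl (ih h.1 z hz').1, .inl (ih h.1 z hz').2⟩

/-- the face permutation. -/
noncomputable def F (m : Fmap) : Perm ℕ := Q m Dim.one * Q m Dim.zero

lemma F_fix {m : Fmap} (h : inv_hmap m) : ∀ z, z ∉ ds m → F m z = z := by
  intro z hz
  rw [mem_ds] at hz
  rw [F, mul_apply, (good m h).qfix _ _ hz, (good m h).qfix _ _ hz]

lemma F_ex {m : Fmap} (h : inv_hmap m) {z : ℕ} (hz : exd m z) : exd m (F m z) := by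
  rw [F, mul_apply, (good m h).exq, (good m h).exq]; exact hz

lemma cF_eq {m : Fmap} (h : inv_hmap m) {z : ℕ} (hz : exd m z) : cF m z = F m z := by
  rw [cF, F, mul_apply, (good m h).q _ z hz, (good m h).q]
  rwa [(good m h).exq]

lemma cF_iter {m : Fmap} (h : inv_hmap m) {z : ℕ} (hz : exd m z) (n : ℕ) :
    (cF m)^[n] z = (F m ^ n) z ∧ exd m ((F m ^ n) z) := by
  induction n with
  | zero => simpa using hz
  | succ n ih =>
    rw [Function.iterate_succ_apply', ih.1, cF_eq h ih.2, pow_succ', mul_apply]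
    exact ⟨rfl, F_ex h ih.2⟩

lemma expf_iff {m : Fmap} (h : inv_hmap m) {z t : ℕ} :
    expf m z t ↔ exd m z ∧ SameCycle (F m) z t := by
  constructor
  · rintro ⟨hz, n, hn⟩
    refine ⟨hz, n, ?_⟩
    rw [zpow_natCast, ← (cF_iter h hz n).1, hn]
  · rintro ⟨hz, hs⟩
    obtain ⟨n, hn⟩ := exists_nat_pow (ds m) (F_fix h) hs
    exact ⟨hz, n, by rw [(cF_iter h hz n).1, hn]⟩

lemma same_ex {m : Fmap} (h : inv_hmap m) {z t : ℕ} (hz : exd m z) (hs : SameCycle (F m) z t) :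
    exd m t := by
  obtain ⟨n, rfl⟩ := exists_nat_pow (ds m) (F_fix h) hs
  exact (cF_iter h hz n).2

lemma same_eqc {m : Fmap} (h : inv_hmap m) {z t : ℕ} (hz : exd m z) (hs : SameCycle (F m) z t) :
    eqc m z t := by
  obtain ⟨n, rfl⟩ := exists_nat_pow (ds m) (F_fix h) hs
  induction n with
  | zero => simpa using eqc_refl hz
  | succ n ih =>
    have ih := ih ⟨n, by simp⟩
    have he := (cF_iter h hz n).2
    rw [pow_succ', mul_apply]
    apply eqc_trans h ih
    apply eqc_symm
    have he' : exd m (Q m Dim.zero ((F m ^ n) z)) := by rwa [(good m h).exq]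
    have h1 := (eqc_Q_bot h Dim.zero _ he).1
    have h2 := (eqc_Q_bot h Dim.one _ he').1
    exact eqc_trans h h2 h1

lemma F_L0 (m : Fmap) (x y : ℕ) :
    F (L m Dim.zero x y) = F m * swap y (bottom m Dim.zero x) := by
  simp [F, Q, mul_assoc]

lemma F_L1 (m : Fmap) (x y : ℕ) :
    F (L m Dim.one x y) = F m * swap ((Q m Dim.zero)⁻¹ y)
      ((Q m Dim.zero)⁻¹ (bottom m Dim.one x)) := by
  have : F (L m Dim.one x y) = Q m Dim.one * swap y (bottom m Dim.one x) * Q m Dim.zero := by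
    simp [F, Q]
  rw [this, F, mul_assoc, mul_assoc]
  congr 1
  rw [mul_swap_eq_swap_mul]
  simp

/-- the condition in nf, dimension zero. -/
lemma expf_L0 {m : Fmap} (h : inv_hmap m) {x y : ℕ} (hp : prec_L m Dim.zero x y) :
    expf m (cA_1 m Dim.one x) y ↔ SameCycle (F m) y (bottom m Dim.zero x) := by
  have g := good m h
  rw [g.prec] at hp
  obtain ⟨hx, hy, hAx, hAy, hb⟩ := hp
  have e : cA_1 m Dim.one x = F m (bottom m Dim.zero x) := by
    rw [F, mul_apply, g.qb _ x hx, g.topx _ x hx hAx, g.q _ x hx]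
  rw [expf_iff h, e, sameCycle_apply_left, sameCycle_comm]
  exact ⟨fun h => h.2, fun h' => ⟨F_ex h (g.exb _ _ hx), h'⟩⟩

lemma expf_L1 {m : Fmap} (h : inv_hmap m) {x y : ℕ} (hp : prec_L m Dim.one x y) :
    expf m x (cA m Dim.zero y) ↔ SameCycle (F m) ((Q m Dim.zero)⁻¹ y)
      ((Q m Dim.zero)⁻¹ (bottom m Dim.one x)) := by
  have g := good m h
  rw [g.prec] at hp
  obtain ⟨hx, hy, hAx, hAy, hb⟩ := hp
  have e : x = F m ((Q m Dim.zero)⁻¹ (bottom m Dim.one x)) := by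
    rw [F, mul_apply, ← mul_apply (Q m Dim.zero), mul_inv_cancel, one_apply, g.qb _ x hx,
      g.topx _ x hx hAx]
  have e2 : cA m Dim.zero y = (Q m Dim.zero)⁻¹ y := by
    rw [eq_inv_iff_eq, g.qc _ y hy]
  rw [expf_iff h, e2]
  conv_lhs => 
    right
    rw [e]
  rw [sameCycle_apply_left, sameCycle_comm]
  exact ⟨fun h => h.2, fun h' => ⟨hx, h'⟩⟩

lemma nf_eq {m : Fmap} (h : inv_hmap m) : nf m = cnt (ds m) (SameCycle (F m)) := by
  induction m with
  | V => simp [nf, cnt, ds]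
  | I m x ih =>
    have : F (I m x) = F m := rfl
    rw [nf, ih h.1, this, ds, cnt_insert (SameCycle.refl _ _)]
    intro z hz hs
    rw [mem_ds] at hz
    exact h.2.2 (same_ex h.1 hz hs)
  | L m k x y ih =>
    have g := good m h.1
    have hp := h.2
    rw [g.prec] at hp
    obtain ⟨hx, hy, hAx, hAy, hb⟩ := hp
    have hex := g.exb k x hx
    cases k with
    | zero =>
      have c := cnt_swap (F_fix h.1) ((mem_ds _ _).2 hy) ((mem_ds _ _).2 hex) hb.symm
      rw [nf, F_L0, ds, ih h.1]
      split_ifs with hc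
      · rw [expf_L0 h.1 h.2] at hc; rw [c.1 hc]
      · rw [expf_L0 h.1 h.2] at hc; rw [c.2 hc]
    | one =>
      have hi : ∀ z, exd m z → (Q m Dim.zero)⁻¹ z ∈ ds m := by
        intro z hz
        rw [mem_ds, ← g.exq Dim.zero, ← mul_apply, mul_inv_cancel]; exact hz
      have c := cnt_swap (F_fix h.1) (hi _ hy) (hi _ hex)
        (fun e => hb.symm ((Q m Dim.zero)⁻¹.injective e))
      rw [nf, F_L1, ds, ih h.1]
      split_ifs with hc
      · rw [expf_L1 h.1 h.2] at hc; rw [c.1 hc]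
      · rw [expf_L1 h.1 h.2] at hc; rw [c.2 hc]

lemma nc_eq {m : Fmap} (h : inv_hmap m) : nc m = cnt (ds m) (eqc m) := by
  induction m with
  | V => simp [nc, cnt, ds]
  | I m x ih =>
    rw [nc, ih h.1, ds, cnt_insert (R := eqc (I m x)) (.inl ⟨rfl, rfl⟩)]
    · congr 1
      unfold cnt
      congr 2
      apply Finset.image_congr
      intro z hz
      have hz' : exd m z := by rw [← mem_ds]; exact hz
      have : z ≠ x := by rintro rfl; exact h.2.2 hz'
      ext t
      simp [eqc, this]
    · intro z hz hc
      rw [mem_ds] at hz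
      rcases hc with ⟨rfl, _⟩ | hc
      · exact h.2.2 hz
      · exact h.2.2 (eqc_exd h.1 hc).2
  | L m k x y ih =>
    rw [nc, ds, eqc_L, ih h.1]
    split_ifs with hc
    · rw [mrg_of_rel (R := eqc m) (fun _ _ => eqc_symm) (fun _ _ _ => eqc_trans h.1) hc]
    · rw [cnt_mrg (fun a ha => eqc_refl ((mem_ds _ _).1 ha)) (fun _ _ => eqc_symm)
        (fun _ _ _ => eqc_trans h.1) ((mem_ds _ _).2 h.2.1) ((mem_ds _ _).2 h.2.2.1) hc]

lemma expf_eqc0 {m : Fmap} (h : inv_hmap m) {x y : ℕ} (hp : prec_L m Dim.zero x y)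
    (he : expf m (cA_1 m Dim.one x) y) : eqc m x y := by
  rw [expf_L0 h hp] at he
  have h1 := same_eqc h hp.2.1 he
  exact eqc_symm (eqc_trans h h1 (eqc_Q_bot h _ _ hp.1).2)

lemma expf_eqc1 {m : Fmap} (h : inv_hmap m) {x y : ℕ} (hp : prec_L m Dim.one x y)
    (he : expf m x (cA m Dim.zero y)) : eqc m x y := by
  have h1 := same_eqc h hp.1 ((expf_iff h).1 he).2
  have h2 := (eqc_Q_bot h Dim.zero _ (eqc_exd h h1).2).1
  rw [(good m h).qc _ _ hp.2.1] at h2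
  exact eqc_trans h h1 (eqc_symm h2)

lemma ec_even {m : Fmap} : ∃ c, ec m = 2 * c := by
  induction m with
  | V => exact ⟨0, by simp [ec, nv, ne, nf, nd]⟩
  | I m x ih =>
    obtain ⟨c, hc⟩ := ih
    exact ⟨c + 1, by simp only [ec, nv, ne, nf, nd] at *; omega⟩
  | L m k x y ih =>
    obtain ⟨c, hc⟩ := ih
    cases k <;> simp only [ec, nv, ne, nf, nd] at * <;> split_ifs
    · exact ⟨c, by omega⟩
    · exact ⟨c - 1, by omega⟩
    · exact ⟨c, by omega⟩
    · exact ⟨c - 1, by omega⟩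

lemma genus_nonneg {m : Fmap} (h : inv_hmap m) : ec m ≤ 2 * nc m := by
  induction m with
  | V => simp [ec, nv, ne, nf, nd, nc]
  | I m x ih =>
    have ih := ih h.1
    simp only [ec, nv, ne, nf, nd, nc] at *; omega
  | L m k x y ih =>
    have ih := ih h.1
    cases k <;> simp only [ec, nv, ne, nf, nd, nc] at *
    · have := expf_eqc0 h.1 h.2
      split_ifs <;> first | omega | (exfalso; tauto)
    · have := expf_eqc1 h.1 h.2
      split_ifs <;> first | omega | (exfalso; tauto)

structure Eqv (m n : Fmap) : Prop where
  ex : exd m = exd n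
  a : A m = A n
  a1 : A_1 m = A_1 n
  b : bottom m = bottom n
  q : Q m = Q n
  c : eqc m = eqc n

lemma Eqv.refl (m : Fmap) : Eqv m m := ⟨rfl, rfl, rfl, rfl, rfl, rfl⟩

lemma Eqv.trans {m n p : Fmap} (h : Eqv m n) (h' : Eqv n p) : Eqv m p :=
  ⟨h.ex.trans h'.ex, h.a.trans h'.a, h.a1.trans h'.a1, h.b.trans h'.b, h.q.trans h'.q,
    h.c.trans h'.c⟩

lemma Eqv.cI {m n : Fmap} (h : Eqv m n) (x : ℕ) : Eqv (I m x) (I n x) := by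
  constructor
  · funext z; simp only [exd, h.ex]
  · funext k z; simp only [A, h.a]
  · funext k z; simp only [A_1, h.a1]
  · funext k z; simp only [bottom, h.b]
  · funext k; simp only [Q, h.q]
  · funext z t; simp only [eqc, h.c]

lemma Eqv.cL {m n : Fmap} (h : Eqv m n) (k : Dim) (x y : ℕ) : Eqv (L m k x y) (L n k x y) := by
  constructor
  · funext z; simp only [exd, h.ex]
  · funext k z; simp only [A, h.a]
  · funext k z; simp only [A_1, h.a1]
  · funext k z; simp only [bottom, h.b]
  · funext k; simp only [Q, h.q, h.b]
  · funext z t; simp only [eqc, h.c]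

lemma Eqv.prec {m n : Fmap} (h : Eqv m n) (hm : inv_hmap m) (hn : inv_hmap n) {k : Dim} {x y : ℕ}
    (hp : prec_L m k x y) : prec_L n k x y := by
  rw [(good m hm).prec] at hp
  rwa [(good n hn).prec, ← h.ex, ← h.a, ← h.a1, ← h.b]

lemma Eqv.F {m n : Fmap} (h : Eqv m n) : F m = F n := by simp only [JC.F, h.q]

lemma Eqv.ds {m n : Fmap} (h : Eqv m n) : ds m = ds n := by
  ext z; rw [mem_ds, mem_ds, h.ex]

lemma Eqv.nf {m n : Fmap} (h : Eqv m n) (hm : inv_hmap m) (hn : inv_hmap n) : nf m = nf n := by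
  rw [nf_eq hm, nf_eq hn, h.F, h.ds]

lemma Eqv.nc {m n : Fmap} (h : Eqv m n) (hm : inv_hmap m) (hn : inv_hmap n) : nc m = nc n := by
  rw [nc_eq hm, nc_eq hn, h.c, h.ds]

lemma mrg_comm {R : ℕ → ℕ → Prop} (sy : ∀ a b, R a b → R b a)
    (tr : ∀ a b c, R a b → R b c → R a c) {x y a b : ℕ}
    (rx : R x x) (ry : R y y) (ra : R a a) (rb : R b b) {z t : ℕ}
    (h : mrg (mrg R x y) a b z t) : mrg (mrg R a b) x y z t := by
  unfold mrg at *
  grind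

lemma swap_L {m : Fmap} {k k' : Dim} {x y a b : ℕ} (h : inv_hmap (L (L m k x y) k' a b)) :
    inv_hmap (L (L m k' a b) k x y) ∧ Eqv (L (L m k x y) k' a b) (L (L m k' a b) k x y) := by
  obtain ⟨⟨h0, h1⟩, h2⟩ := h
  have g := good m h0
  have g1 := good_L g h1
  have e1 := (g.prec _ _ _).1 h1
  have e2 := (g1.prec _ _ _).1 h2
  obtain ⟨hx, hy, hAx, hAy, hb⟩ := e1
  obtain ⟨ha, hb', hAa, hAb, hbb⟩ := e2
  have ha : exd m a := ha
  have hb' : exd m b := hb'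
  have hx0 := g.nz _ hx
  have hy0 := g.nz _ hy
  have ha0 := g.nz _ ha
  have hb0 := g.nz _ hb'
  simp only [A, A_1, bottom] at hAa hAb hbb
  have key : k' = k → x ≠ a ∧ y ≠ b ∧ A m k' a = 0 ∧ A_1 m k' b = 0 ∧ bottom m k' a ≠ b ∧
      ¬ (bottom m k a = y ∧ bottom m k x = b) := by
    rintro rfl
    simp only [if_true] at hAa hAb hbb
    have := g.boty k' y hy hAy
    grind
  have p1 : prec_L m k' a b := by
    rw [g.prec]
    by_cases hk : k' = k
    · obtain ⟨_, _, h3, h4, h5, _⟩ := key hk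
      exact ⟨ha, hb', h3, h4, h5⟩
    · simp only [hk, if_false] at hAa hAb hbb
      exact ⟨ha, hb', hAa, hAb, hbb⟩
  have g2 := good_L g p1
  have p2 : prec_L (L m k' a b) k x y := by
    rw [g2.prec]
    refine ⟨hx, hy, ?_, ?_, ?_⟩
    · simp only [A]
      by_cases hk : k' = k
      · obtain ⟨h1, _⟩ := key hk; simp [hk, h1, hAx]
      · simp [Ne.symm hk, hAx]
    · simp only [A_1]
      by_cases hk : k' = k
      · obtain ⟨_, h1, _⟩ := key hk; simp [hk, h1, hAy]
      · simp [Ne.symm hk, hAy]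
    · simp only [bottom]
      by_cases hk : k' = k
      · obtain ⟨_, h1, _, _, _, h6⟩ := key hk
        subst hk
        simp only [if_true]
        grind
      · simp [Ne.symm hk, hb]
  refine ⟨⟨⟨h0, p1⟩, p2⟩, ?_⟩
  have hbot : bottom m k' a = bottom m k' x → k' = k → x = a := by
    intro e hk
    have h3 := (key hk).2.2.1
    subst hk
    have q1 := g.qb k' a ha
    have q2 := g.qb k' x hx
    rw [e, q2, g.topx k' x hx hAx, g.topx k' a ha h3] at q1
    exact q1
  clear hAa hAb hbb g1 g2 h1 h2 p1 p2
  constructor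
  · rfl
  · funext k'' z; simp only [A]
    by_cases hk : k' = k
    · obtain ⟨h1, _⟩ := key hk; subst hk; grind
    · grind
  · funext k'' z; simp only [A_1]
    by_cases hk : k' = k
    · obtain ⟨_, h1, _⟩ := key hk; subst hk; grind
    · grind
  · funext k'' z
    by_cases hk : k' = k
    · obtain ⟨h1, h2, h3, h4, h5, h6⟩ := key hk; subst hk
      simp only [bottom]
      split_ifs <;> grind
    · simp only [bottom]
      split_ifs <;> grind
  · funext k''
    by_cases hk : k' = k
    · obtain ⟨h1, h2, h3, h4, h5, h6⟩ := key hk; subst hk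
      by_cases hk2 : k'' = k'
      · subst hk2
        simp only [Q, if_true, mul_assoc, bottom]
        congr 1
        have hbx : bottom m k'' a ≠ bottom m k'' x := fun e => h1 (hbot e rfl)
        clear hbot key g
        generalize bottom m k'' x = u at *
        generalize bottom m k'' a = v at *
        by_cases c1 : v = y
        · subst c1
          have : u ≠ b := fun e => h6 ⟨rfl, e⟩
          simp only [if_true, if_neg this]
          ext z
          simp only [mul_apply, swap_apply_def]
          grind
        · by_cases c2 : u = b
          · subst c2
            simp only [if_true, if_neg c1]
            ext z
            simp only [mul_apply, swap_apply_def]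
            grind
          · simp only [if_neg c1, if_neg c2]
            ext z
            simp only [mul_apply, swap_apply_def]
            grind
      · simp only [Q, if_neg hk2]
    · simp only [Q, bottom]
      by_cases hk2 : k'' = k'
      · subst hk2; simp [hk]
      · simp [hk2, Ne.symm hk]
  · funext z t
    rw [eqc_L, eqc_L, eqc_L, eqc_L]
    apply propext
    have := eqc_refl hx
    have := eqc_refl hy
    have := eqc_refl ha
    have := eqc_refl hb'
    constructor <;> apply mrg_comm (R := eqc m) (fun _ _ => eqc_symm) (fun _ _ _ => eqc_trans h0) <;> assumption

lemma swap_I {m : Fmap} {k : Dim} {x y a : ℕ} (h : inv_hmap (I (L m k x y) a)) :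
    inv_hmap (L (I m a) k x y) ∧ Eqv (I (L m k x y) a) (L (I m a) k x y) := by
  obtain ⟨⟨h0, h1⟩, h2⟩ := h
  have g := good m h0
  have h2' : prec_I m a := h2
  have g1 := good_I g h2'
  obtain ⟨hx, hy, hAx, hAy, hb⟩ := (g.prec _ _ _).1 h1
  have hxa : x ≠ a := by rintro rfl; exact h2'.2 hx
  have hya : y ≠ a := by rintro rfl; exact h2'.2 hy
  refine ⟨⟨⟨h0, h2'⟩, ?_⟩, ?_⟩
  · rw [g1.prec]
    simp only [A, A_1, bottom, exd]
    simp [*]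
  · constructor
    · rfl
    · rfl
    · rfl
    · funext k' z
      simp only [bottom]
      grind
    · funext k'
      simp only [Q, bottom, if_neg hxa]
    · funext z t
      have ex : ∀ z t, eqc m z t → z ≠ a ∧ t ≠ a := by
        intro z t he
        have := eqc_exd h0 he
        constructor <;> rintro rfl
        · exact h2'.2 this.1
        · exact h2'.2 this.2
      simp only [eqc]
      apply propext
      grind

lemma A_L_ne {m : Fmap} {k0 k : Dim} {a b x : ℕ} (hn : ¬ (k = k0 ∧ x = a)) :
    A (L m k0 a b) k x = A m k x := by
  simp only [A]; grind

lemma B_spec {m : Fmap} (h : inv_hmap m) {k : Dim} {x : ℕ} (hs : A m k x ≠ 0) :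
    inv_hmap (L (B m k x) k x (A m k x)) ∧ Eqv m (L (B m k x) k x (A m k x)) := by
  induction m with
  | V => exact absurd rfl hs
  | I m a ih =>
    have hs' : A m k x ≠ 0 := hs
    obtain ⟨i1, i2⟩ := ih h.1 hs'
    have hp : prec_I (L (B m k x) k x (A m k x)) a := ⟨h.2.1, by rw [← i2.ex]; exact h.2.2⟩
    obtain ⟨j1, j2⟩ := swap_I ⟨i1, hp⟩
    exact ⟨j1, (i2.cI a).trans j2⟩
  | L m k0 a b ih =>
    by_cases hc : k = k0 ∧ x = a
    · obtain ⟨rfl, rfl⟩ := hc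
      have e1 : B (L m k x b) k x = m := by simp [B]
      have e2 : A (L m k x b) k x = b := by simp [A]
      rw [e1, e2]
      exact ⟨h, Eqv.refl _⟩
    · have e1 : B (L m k0 a b) k x = L (B m k x) k0 a b := by simp only [B, if_neg hc]
      rw [A_L_ne hc] at hs ⊢
      rw [e1]
      obtain ⟨i1, i2⟩ := ih h.1 hs
      obtain ⟨j1, j2⟩ := swap_L ⟨i1, i2.prec h.1 i1 h.2⟩
      exact ⟨j1, (i2.cL k0 a b).trans j2⟩

lemma B_nd (m : Fmap) (k : Dim) (x : ℕ) : nd (B m k x) = nd m := by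
  induction m with
  | V => rfl
  | I m a ih => simp [B, nd, ih]
  | L m k0 a b ih => simp only [B]; split_ifs <;> simp [nd, ih]

lemma B_nv (m : Fmap) (x : ℕ) : nv (B m Dim.zero x) = nv m := by
  induction m with
  | V => rfl
  | I m a ih => simp [B, nv, ih]
  | L m k0 a b ih => cases k0 <;> simp only [B] <;> split_ifs <;> simp_all [nv]

lemma B_ne (m : Fmap) (x : ℕ) (hs : A m Dim.zero x ≠ 0) : ne (B m Dim.zero x) = ne m + 1 := by
  induction m with
  | V => exact absurd rfl hs
  | I m a ih => simp only [B, ne]; rw [ih hs]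
  | L m k0 a b ih =>
    by_cases hc : Dim.zero = k0 ∧ x = a
    · obtain ⟨rfl, rfl⟩ := hc; simp [B, ne]
    · rw [A_L_ne hc] at hs
      simp only [B, if_neg hc]
      cases k0 <;> simp only [ne, ih hs]; ring

/-- the other dart of a double-link. -/
def od (m : Fmap) (p : ℕ × Bool) : ℕ :=
  if p.2 then bottom m Dim.zero p.1 else A m Dim.zero p.1

lemma adj_iff (m : Fmap) (p q : ℕ × Bool) :
    adjacent_faces m p q ↔ expf m (od m p) (faceDart m q) := by
  obtain ⟨x, b⟩ := p
  obtain ⟨x', b'⟩ := q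
  cases b <;> cases b' <;> simp [adjacent_faces, od, faceDart]

/-- semantic version of rings. -/
structure RG (m : Fmap) (p : ℕ × Bool) (l : List (ℕ × Bool)) : Prop where
  e : (p :: l).Pairwise (fun p q => bottom m Dim.zero p.1 ≠ bottom m Dim.zero q.1)
  s : ∀ q ∈ p :: l, A m Dim.zero q.1 ≠ 0
  c : (p :: l).IsChain (fun p q => SameCycle (F m) (od m p) (faceDart m q))
  r : SameCycle (F m) (od m (lastd (p :: l))) (faceDart m p)
  d : (p :: l).Pairwise (fun p q => ¬ SameCycle (F m) (faceDart m p) (faceDart m q))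

lemma expe_of_bottom {m : Fmap} (h : inv_hmap m) {x x' : ℕ} (hx : exd m x) (hx' : exd m x')
    (he : bottom m Dim.zero x = bottom m Dim.zero x') : expe m x x' := by
  have g := good m h
  have hs : SameCycle (Q m Dim.zero)⁻¹ x x' := sameCycle_inv.2 ((g.same_iff hx hx').2 he)
  have hfix : ∀ z, z ∉ ds m → (Q m Dim.zero)⁻¹ z = z := by
    intro z hz
    rw [mem_ds] at hz
    rw [inv_eq_iff_eq, g.qfix _ _ hz]
  obtain ⟨n, hn⟩ := exists_nat_pow (ds m) hfix hs
  refine ⟨hx, n, ?_⟩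
  rw [← hn]
  clear hn
  have : (fun w => cA m Dim.zero w)^[n] x = ((Q m Dim.zero)⁻¹ ^ n) x ∧
      exd m (((Q m Dim.zero)⁻¹ ^ n) x) := by
    induction n with
    | zero => simpa using hx
    | succ n ih =>
      rw [Function.iterate_succ_apply', ih.1, pow_succ', mul_apply]
      refine ⟨?_, ?_⟩
      · rw [eq_inv_iff_eq, g.qc _ _ ih.2]
      · rw [← g.exq Dim.zero, ← mul_apply, mul_inv_cancel]; exact ih.2
  exact this.1

lemma del_iff (m : Fmap) (x : ℕ) (l : List (ℕ × Bool)) (h : distinct_edge_list m x l) :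
    ∀ q ∈ l, ¬ expe m x q.1 := by
  induction l with
  | nil => simp
  | cons q l ih =>
    simp only [List.mem_cons, forall_eq_or_imp]
    exact ⟨h.2, ih h.1⟩

lemma ring0_succ (m : Fmap) (l : List (ℕ × Bool)) (h : pre_ring0 m l) :
    (∀ q ∈ l, A m Dim.zero q.1 ≠ 0) ∧ l.Pairwise (fun p q => ¬ expe m p.1 q.1) := by
  induction l with
  | nil => simp
  | cons q l ih =>
    obtain ⟨h1, h2, h3⟩ := h
    simp only [List.mem_cons, forall_eq_or_imp, List.pairwise_cons]
    exact ⟨⟨h3, (ih h1).1⟩, del_iff m _ l h2, (ih h1).2⟩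

lemma ring1_chain (m : Fmap) (l : List (ℕ × Bool)) (h : pre_ring1 m l) :
    l.IsChain (adjacent_faces m) := by
  induction l with
  | nil => simp
  | cons p l ih =>
    cases l with
    | nil => simp
    | cons q l =>
      rw [List.isChain_cons_cons]
      exact ⟨h.2, ih h.1⟩

lemma dfl (m : Fmap) (p : ℕ × Bool) (l : List (ℕ × Bool)) (h : distinct_face_list m p l) :
    ∀ q ∈ l, distinct_faces m p q := by
  induction l with
  | nil => simp
  | cons q l ih =>
    simp only [List.mem_cons, forall_eq_or_imp]
    exact ⟨h.2, ih h.1⟩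

lemma ring3_pw (m : Fmap) (l : List (ℕ × Bool)) (h : pre_ring3 m l) :
    l.Pairwise (distinct_faces m) := by
  induction l with
  | nil => simp
  | cons p l ih =>
    rw [List.pairwise_cons]
    exact ⟨dfl m p l h.2, ih h.1⟩

lemma lastd_cons (p q : ℕ × Bool) (l : List (ℕ × Bool)) : lastd (p :: q :: l) = lastd (q :: l) := rfl

lemma lastd_mem (p : ℕ × Bool) (l : List (ℕ × Bool)) : lastd (p :: l) ∈ p :: l := by
  induction l generalizing p with
  | nil => simp [lastd]
  | cons q l ih => rw [lastd_cons]; exact List.mem_cons_of_mem _ (ih q)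

lemma RG_of_ring {m : Fmap} (h : inv_hmap m) {p : ℕ × Bool} {l : List (ℕ × Bool)}
    (hr : Fmap.ring m (p :: l)) : RG m p l := by
  obtain ⟨-, h0, h1, h2, h3⟩ := hr
  have g := good m h
  obtain ⟨hs, hp⟩ := ring0_succ m _ h0
  have hex : ∀ q ∈ p :: l, exd m q.1 := fun q hq => (g.Aex _ _ (hs q hq)).1
  have hfd : ∀ q ∈ p :: l, exd m (faceDart m q) := by
    rintro ⟨x, b⟩ hq
    simp only [faceDart]
    split_ifs
    · exact (g.Aex _ _ (hs _ hq)).2.1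
    · exact g.exb _ _ (hex _ hq)
  refine ⟨?_, hs, ?_, ?_, ?_⟩
  · refine hp.imp_of_mem ?_
    intro a b ha hb hn he
    exact hn (expe_of_bottom h (hex a ha) (hex b hb) he)
  · refine (ring1_chain m _ h1).imp ?_
    intro a b hab
    rw [adj_iff, expf_iff h] at hab
    exact hab.2
  · cases l with
    | nil =>
      obtain ⟨x, b⟩ := p
      have h2' : expf m (A m Dim.zero x) (bottom m Dim.zero x) := h2
      rw [expf_iff h] at h2'
      cases b
      · simpa [lastd, od, faceDart] using h2'.2
      · simpa [lastd, od, faceDart] using h2'.2.symm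
    | cons q l =>
      have h2' : adjacent_faces m (lastd (q :: l)) p := h2
      rw [adj_iff, expf_iff h] at h2'
      rw [lastd_cons]; exact h2'.2
  · refine (ring3_pw m _ h3).imp_of_mem ?_
    intro a b ha _ hn hc
    exact hn ((expf_iff h).2 ⟨hfd a ha, hc⟩)

lemma swap_fd (m : Fmap) (p : ℕ × Bool) :
    swap (A m Dim.zero p.1) (bottom m Dim.zero p.1) = swap (faceDart m p) (od m p) := by
  obtain ⟨x, b⟩ := p
  cases b
  · simp [faceDart, od, swap_comm]
  · simp [faceDart, od]

lemma main (l : List (ℕ × Bool)) : ∀ (m : Fmap) (p : ℕ × Bool), inv_hmap m → planar m →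
    RG m p l → nc (Bl m (p :: l)) = nc m + 1 := by
  induction l with
  | nil =>
    intro m p h hpl hr
    obtain ⟨x, b⟩ := p
    have hs : A m Dim.zero x ≠ 0 := hr.s (x, b) (by simp)
    obtain ⟨⟨i0, i1⟩, i2⟩ := B_spec h hs
    have hnf := i2.nf h ⟨i0, i1⟩
    have hnc := i2.nc h ⟨i0, i1⟩
    have hF := i2.F
    have hbx := (((good _ i0).prec _ _ _).1 i1).2.2.2.2
    have hne := B_ne m x hs
    have hnv := B_nv m x
    have hnd := B_nd m Dim.zero x
    have hbb : bottom m Dim.zero x = bottom (B m Dim.zero x) Dim.zero x := by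
      rw [i2.b]; simp [bottom, hbx]
    have hr' : SameCycle (F m) (A m Dim.zero x) (bottom m Dim.zero x) := by
      have := hr.r
      cases b
      · simpa [lastd, od, faceDart] using this
      · simpa [lastd, od, faceDart] using this.symm
    have hg := genus_nonneg i0
    obtain ⟨c, hc⟩ := ec_even (m := m)
    rw [F_L0, ← hbb] at hF
    have hF' : F (B m Dim.zero x) = F m * swap (A m Dim.zero x) (bottom m Dim.zero x) := by
      rw [hF, mul_assoc, swap_mul_self, mul_one]
    have hns := not_sameCycle_of (by rw [hbb]; exact hbx.symm) hr'
    rw [← hF', hbb, ← expf_L0 i0 i1] at hns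
    rw [Fmap.nf, if_neg hns] at hnf
    show nc (B m Dim.zero x) = nc m + 1
    rw [Fmap.nc] at hnc
    unfold planar genus at hpl
    unfold ec at *
    split_ifs at hnc <;> omega
  | cons q l ih =>
    intro m p h hpl hr
    obtain ⟨x, b⟩ := p
    have hs : A m Dim.zero x ≠ 0 := hr.s (x, b) (by simp)
    obtain ⟨⟨i0, i1⟩, i2⟩ := B_spec h hs
    have hnf := i2.nf h ⟨i0, i1⟩
    have hnc := i2.nc h ⟨i0, i1⟩
    have hF := i2.F
    have hbx := (((good _ i0).prec _ _ _).1 i1).2.2.2.2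
    have hne := B_ne m x hs
    have hnv := B_nv m x
    have hnd := B_nd m Dim.zero x
    have hbb : bottom m Dim.zero x = bottom (B m Dim.zero x) Dim.zero x := by
      rw [i2.b]; simp [bottom, hbx]
    rw [F_L0, ← hbb] at hF
    have hF' : F (B m Dim.zero x) = F m * swap (A m Dim.zero x) (bottom m Dim.zero x) := by
      rw [hF, mul_assoc, swap_mul_self, mul_one]
    have hd := hr.d
    have hchain := hr.c
    have he := hr.e
    rw [List.isChain_cons_cons] at hchain
    rw [List.pairwise_cons] at hd he
    have hsw := swap_fd m (x, b)
    simp only at hsw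
    have hnuo : ¬ SameCycle (F m) (faceDart m (x, b)) (od m (x, b)) := by
      intro hc
      exact hd.1 q (by simp) (hc.trans hchain.1)
    have hF2 := hF'
    rw [hsw] at hF2
    have hmrg := sameCycle_iff_mrg (ds m) (F_fix h) hnuo
    rw [← hF2] at hmrg
    have hup : ∀ a b, SameCycle (F m) a b → SameCycle (F (B m Dim.zero x)) a b :=
      fun a b hab => (hmrg a b).2 (.inl hab)
    have huo : SameCycle (F (B m Dim.zero x)) (faceDart m (x, b)) (od m (x, b)) :=
      (hmrg _ _).2 (.inr (.inl ⟨SameCycle.refl _ _, SameCycle.refl _ _⟩))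
    have hyx : SameCycle (F (B m Dim.zero x)) (A m Dim.zero x) (bottom m Dim.zero x) := by
      cases b
      · simpa [od, faceDart] using huo.symm
      · simpa [od, faceDart] using huo
    have hexp : expf (B m Dim.zero x) (cA_1 (B m Dim.zero x) Dim.one x) (A m Dim.zero x) := by
      rw [expf_L0 i0 i1, ← hbb]; exact hyx
    have heq := expf_eqc0 i0 i1 hexp
    rw [Fmap.nf, if_pos hexp] at hnf
    rw [Fmap.nc, if_pos heq] at hnc
    show nc (Bl (B m Dim.zero x) (q :: l)) = nc m + 1
    rw [hnc]
    have hA : ∀ r ∈ q :: l, A (B m Dim.zero x) Dim.zero r.1 = A m Dim.zero r.1 := by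
      intro r hrm
      have : r.1 ≠ x := fun e => he.1 r hrm (by rw [e])
      conv_rhs => rw [i2.a]
      simp [A, this]
    have hB : ∀ r ∈ q :: l, bottom (B m Dim.zero x) Dim.zero r.1 = bottom m Dim.zero r.1 := by
      intro r hrm
      have h1 : bottom m Dim.zero x ≠ bottom m Dim.zero r.1 := he.1 r hrm
      have h2 : bottom m Dim.zero r.1 = if bottom (B m Dim.zero x) Dim.zero r.1 = A m Dim.zero x
          then bottom (B m Dim.zero x) Dim.zero x else bottom (B m Dim.zero x) Dim.zero r.1 := by
        conv_lhs => rw [i2.b]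
        simp [bottom]
      split_ifs at h2 with hc
      · exact absurd (hbb.trans h2.symm) h1
      · exact h2.symm
    have hfd : ∀ r ∈ q :: l, faceDart (B m Dim.zero x) r = faceDart m r := by
      rintro ⟨r, b'⟩ hrm
      have h1 := hA _ hrm
      have h2 := hB _ hrm
      simp only at h1 h2
      simp only [faceDart, h1, h2]
    have hod : ∀ r ∈ q :: l, od (B m Dim.zero x) r = od m r := by
      intro r hrm
      simp only [od, hA r hrm, hB r hrm]
    apply ih _ _ i0
    · unfold planar genus at *
      have : ec (B m Dim.zero x) = ec m := by unfold ec; omega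
      rw [this, ← hnc]; exact hpl
    · constructor
      · refine he.2.imp_of_mem ?_
        intro a b ha hb hab
        rw [hB a ha, hB b hb]; exact hab
      · intro r hrm
        rw [hA r hrm]; exact hr.s r (List.mem_cons_of_mem _ hrm)
      · refine hchain.2.imp_of_mem_imp ?_
        intro a b ha hb hab
        rw [hod a ha, hfd b hb]; exact hup _ _ hab
      · have h1 := hup _ _ hr.r
        rw [lastd_cons] at h1
        rw [hod _ (lastd_mem q l), hfd q (by simp)]
        exact (h1.trans huo).trans (hup _ _ hchain.1)
      · refine hd.2.imp_of_mem ?_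
        intro a b ha hb hab
        rw [hfd a ha, hfd b hb, hmrg]
        rintro (h1 | ⟨h1, _⟩ | ⟨_, h1⟩)
        · exact hab h1
        · exact hd.1 a ha h1.symm
        · exact hd.1 b hb h1

end JC

/-- Discrete Jordan Curve Theorem. -/
theorem Jordan (l : List (Nat × Bool)) (m : Fmap)
    (h1 : inv_hmap m) (h2 : planar m) (h3 : ring m l) :
    nc (Bl m l) = nc m + 1 := by
  cases l with
  | nil => exact absurd rfl h3.1
  | cons p l => exact JC.main l m p h1 h2 (JC.RG_of_ring h1 h3)
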